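/- arXiv:2007.06169 — 2 statements merged into one kernel-verified Lean document; each statement's English description precedes it below -/
import Mathlib

section
/- Let (Ỹ, ℬ, Q) be a probability space and let g₁, g₂ : Ỹ → [0,∞) be measurable (finite-valued) functions. Then 2·∫ ( e^{|log((1+g₁)/(1+g₂))|} − 1 − |log((1+g₁)/(1+g₂))| ) dQ ≤ 8·∫ (√g₁ − √g₂)² dQ. -/
open MeasureTheory
open scoped ENNReal

theorem aux_pt (a b : ℝ) (hb : 0 ≤ b) (hab : b ≤ a) :
    Real.exp |Real.log ((1 + a ^ 2) / (1 + b ^ 2))| - 1 -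
      |Real.log ((1 + a ^ 2) / (1 + b ^ 2))| ≤ 4 * (a - b) ^ 2 := by
  have hr1 : 1 ≤ (1 + a ^ 2) / (1 + b ^ 2) := by
    rw [le_div_iff₀ (by positivity)]
    nlinarith
  have hru : (1 + a ^ 2) / (1 + b ^ 2) ≤ (1 + (a - b)) ^ 2 := by
    rw [div_le_iff₀ (by positivity)]
    have hd : 0 ≤ a - b := by linarith
    nlinarith [mul_nonneg hd (sq_nonneg (b - 1)), mul_nonneg hd (sq_nonneg b),
      sq_nonneg ((a - b) * b)]
  generalize (1 + a ^ 2) / (1 + b ^ 2) = r at hr1 hru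
  rw [abs_of_nonneg (Real.log_nonneg hr1), Real.exp_log (by linarith)]
  obtain ⟨s, hs, rfl⟩ : ∃ s : ℝ, 1 ≤ s ∧ s ^ 2 = r :=
    ⟨√r, Real.one_le_sqrt.2 hr1, Real.sq_sqrt (by linarith)⟩
  have hsd : s ≤ 1 + (a - b) := (sq_le_sq₀ (by linarith) (by linarith)).1 hru
  have hl : 1 - s⁻¹ ≤ Real.log s := Real.one_sub_inv_le_log_of_pos (by linarith)
  have h1 : (s - 1) ^ 2 ≤ (a - b) ^ 2 := by
    apply pow_le_pow_left₀ <;> linarith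
  have h2 : s ^ 2 - 3 + 2 * s⁻¹ ≤ 3 * (s - 1) ^ 2 := by
    have : 3 * (s - 1) ^ 2 - (s ^ 2 - 3 + 2 * s⁻¹) = 2 * (s - 1) ^ 3 / s := by
      field_simp
      ring
    have : 0 ≤ 2 * (s - 1) ^ 3 / s := by
      have : 0 ≤ s - 1 := by linarith
      positivity
    linarith
  rw [Real.log_pow]
  push_cast
  nlinarith [sq_nonneg (a - b)]

theorem aux_pt_gen (x y : ℝ) (hx : 0 ≤ x) (hy : 0 ≤ y) :
    Real.exp |Real.log ((1 + x) / (1 + y))| - 1 -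
      |Real.log ((1 + x) / (1 + y))| ≤ 4 * (√x - √y) ^ 2 := by
  rcases le_total (√y) (√x) with h | h
  · have := aux_pt _ _ (Real.sqrt_nonneg y) h
    rwa [Real.sq_sqrt hx, Real.sq_sqrt hy] at this
  · have := aux_pt _ _ (Real.sqrt_nonneg x) h
    rw [Real.sq_sqrt hx, Real.sq_sqrt hy, ← inv_div, Real.log_inv, abs_neg] at this
    linarith [sq_abs (√x - √y), sub_sq_comm (√x) (√y)]

/-- Abstract form of the second log-discriminator-ratio bound: on a probability space `Q`,
for measurable `g₁, g₂ : Ỹ → [0,∞)`,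
`2∫(e^{|log((1+g₁)/(1+g₂))|} − 1 − |log((1+g₁)/(1+g₂))|) dQ ≤ 8∫(√g₁ − √g₂)² dQ`. -/
theorem stmt6 {Y : Type*} [MeasurableSpace Y] (Q : Measure Y) [IsProbabilityMeasure Q]
    (g₁ g₂ : Y → ℝ) (hg₁m : Measurable g₁) (hg₂m : Measurable g₂)
    (hg₁0 : ∀ y, 0 ≤ g₁ y) (hg₂0 : ∀ y, 0 ≤ g₂ y) :
    2 * ∫⁻ y, ENNReal.ofReal
        (Real.exp |Real.log ((1 + g₁ y) / (1 + g₂ y))| - 1 -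
          |Real.log ((1 + g₁ y) / (1 + g₂ y))|) ∂Q ≤
      8 * ∫⁻ y, ENNReal.ofReal ((Real.sqrt (g₁ y) - Real.sqrt (g₂ y)) ^ 2) ∂Q := by
  have key : ∫⁻ y, ENNReal.ofReal
        (Real.exp |Real.log ((1 + g₁ y) / (1 + g₂ y))| - 1 -
          |Real.log ((1 + g₁ y) / (1 + g₂ y))|) ∂Q ≤
      4 * ∫⁻ y, ENNReal.ofReal ((Real.sqrt (g₁ y) - Real.sqrt (g₂ y)) ^ 2) ∂Q := by
    rw [← lintegral_const_mul' _ _ (by norm_num)]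
    refine lintegral_mono fun y => ?_
    refine (ENNReal.ofReal_le_ofReal (aux_pt_gen _ _ (hg₁0 y) (hg₂0 y))).trans ?_
    rw [ENNReal.ofReal_mul (by norm_num)]
    simp
  refine (mul_le_mul_right key 2).trans ?_
  rw [← mul_assoc]
  norm_num
end

section
/- Let (X, 𝒜, μ) be a σ-finite measure space, let p₀ and p_θ be probability densities with respect to μ, and let D_θ = p₀/(p₀+p_θ) (set to 1/2 where p₀+p_θ = 0). Let ℓ, u : X → [0,∞) be measurable with ℓ ≤ u pointwise. Then, with r := (u+D_θ)/(ℓ+D_θ) ≥ 1 on {p₀ > 0}, 2·∫_{{p₀>0}} ( e^{log r} − 1 − log r ) p₀ dμ ≤ 4·∫ (√u − √ℓ)² (p₀+p_θ) dμ. -/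
open MeasureTheory
open scoped ENNReal

/-- The oracle discriminator `D_θ = p₀/(p₀+p_θ)` (set to `1/2` where `p₀+p_θ = 0`). -/
noncomputable def oracleD {X : Type*} (p₀ pθ : X → ℝ) (x : X) : ℝ :=
  if 0 < p₀ x + pθ x then p₀ x / (p₀ x + pθ x) else 1 / 2

theorem aux_log (s : ℝ) (hs : 1 ≤ s) : s ^ 2 - 1 - Real.log (s ^ 2) ≤ 2 * (s - 1) ^ 2 := by
  have h := Real.le_log_one_add_of_nonneg (x := s - 1) (by linarith)
  have h2 : (s - 1) - (s - 1) ^ 2 / 2 ≤ 2 * (s - 1) / (s - 1 + 2) := by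
    rw [le_div_iff₀ (by linarith)]
    have : 0 ≤ (s - 1) ^ 3 := pow_nonneg (by linarith) 3
    nlinarith
  rw [add_sub_cancel] at h
  rw [Real.log_pow]
  push_cast
  nlinarith

theorem aux_pt_s11 (u l D : ℝ) (hl : 0 ≤ l) (hlu : l ≤ u) (hD : 0 < D) :
    ((u + D) / (l + D) - 1 - Real.log ((u + D) / (l + D))) * D
      ≤ 2 * (Real.sqrt u - Real.sqrt l) ^ 2 := by
  have hA := Real.sq_sqrt (show 0 ≤ u + D by linarith)
  have hB := Real.sq_sqrt (show 0 ≤ l + D by linarith)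
  have ha := Real.sq_sqrt (show 0 ≤ u by linarith)
  have hb := Real.sq_sqrt hl
  have hAa : Real.sqrt u ≤ Real.sqrt (u + D) := Real.sqrt_le_sqrt (by linarith)
  have hBb : Real.sqrt l ≤ Real.sqrt (l + D) := Real.sqrt_le_sqrt (by linarith)
  have hAB : Real.sqrt (l + D) ≤ Real.sqrt (u + D) := Real.sqrt_le_sqrt (by linarith)
  have hab : Real.sqrt l ≤ Real.sqrt u := Real.sqrt_le_sqrt hlu
  have hB0 : 0 < Real.sqrt (l + D) := Real.sqrt_pos.2 (by linarith)
  have hb0 := Real.sqrt_nonneg l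
  set A := Real.sqrt (u + D)
  set B := Real.sqrt (l + D)
  set a := Real.sqrt u
  set b := Real.sqrt l
  have hr : (u + D) / (l + D) = (A / B) ^ 2 := by rw [div_pow, hA, hB]
  have hs : 1 ≤ A / B := (one_le_div hB0).2 hAB
  have h1 := aux_log _ hs
  rw [hr]
  have hk : A - B ≤ a - b := by
    by_contra hc
    push Not at hc
    nlinarith [mul_pos (sub_pos.2 hc) (show 0 < A + B by linarith),
      mul_nonneg (sub_nonneg.2 hab) (show 0 ≤ A + B - (a + b) by linarith)]
  have h2 : (A / B - 1) ^ 2 * D ≤ (A - B) ^ 2 := by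
    have : (A / B - 1) ^ 2 * D = (A - B) ^ 2 * (D / B ^ 2) := by
      field_simp
    rw [this]
    have h3 : D / B ^ 2 ≤ 1 := by
      rw [hB]
      exact (div_le_one (by linarith)).2 (by linarith)
    exact mul_le_of_le_one_right (sq_nonneg _) h3
  have h4 : (A - B) ^ 2 ≤ (a - b) ^ 2 := pow_le_pow_left₀ (by linarith) hk 2
  have h5 := mul_le_mul_of_nonneg_right h1 hD.le
  linarith

/-- Bracketing-transfer bound for the pseudo-cross-entropy discriminator: for measurable
`ℓ ≤ u` with values in `[0,∞)`, the ratio `r = (u+D_θ)/(ℓ+D_θ)` satisfies `r ≥ 1` on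
`{p₀ > 0}` and `2∫_{p₀>0}(e^{log r} − 1 − log r) p₀ dμ ≤ 4∫(√u−√ℓ)²(p₀+p_θ) dμ`. -/
theorem stmt11 {X : Type*} [MeasurableSpace X] (μ : Measure X) [SigmaFinite μ]
    (p₀ pθ : X → ℝ) (hp₀m : Measurable p₀) (hpθm : Measurable pθ)
    (hp₀0 : ∀ x, 0 ≤ p₀ x) (hpθ0 : ∀ x, 0 ≤ pθ x)
    (hp₀1 : ∫⁻ x, ENNReal.ofReal (p₀ x) ∂μ = 1)
    (hpθ1 : ∫⁻ x, ENNReal.ofReal (pθ x) ∂μ = 1)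
    (l u : X → ℝ) (hlm : Measurable l) (hum : Measurable u)
    (hl0 : ∀ x, 0 ≤ l x) (hlu : ∀ x, l x ≤ u x) :
    (∀ x, 0 < p₀ x →
      1 ≤ (u x + oracleD p₀ pθ x) / (l x + oracleD p₀ pθ x)) ∧
    2 * ∫⁻ x in {x | 0 < p₀ x}, ENNReal.ofReal
        ((Real.exp (Real.log ((u x + oracleD p₀ pθ x) / (l x + oracleD p₀ pθ x))) - 1 -
            Real.log ((u x + oracleD p₀ pθ x) / (l x + oracleD p₀ pθ x))) * p₀ x) ∂μ ≤
      4 * ∫⁻ x, ENNReal.ofReal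
        ((Real.sqrt (u x) - Real.sqrt (l x)) ^ 2 * (p₀ x + pθ x)) ∂μ := by
  have hD : ∀ x, 0 < p₀ x → 0 < oracleD p₀ pθ x ∧
      oracleD p₀ pθ x * (p₀ x + pθ x) = p₀ x := by
    intro x hx
    have hS : 0 < p₀ x + pθ x := by linarith [hpθ0 x]
    rw [oracleD, if_pos hS]
    exact ⟨div_pos hx hS, div_mul_cancel₀ _ hS.ne'⟩
  refine ⟨fun x hx => ?_, ?_⟩
  · have := (hD x hx).1
    rw [one_le_div (by linarith [hl0 x])]
    linarith [hlu x]
  have key : ∫⁻ x in {x | 0 < p₀ x}, ENNReal.ofReal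
        ((Real.exp (Real.log ((u x + oracleD p₀ pθ x) / (l x + oracleD p₀ pθ x))) - 1 -
            Real.log ((u x + oracleD p₀ pθ x) / (l x + oracleD p₀ pθ x))) * p₀ x) ∂μ ≤
      2 * ∫⁻ x, ENNReal.ofReal
        ((Real.sqrt (u x) - Real.sqrt (l x)) ^ 2 * (p₀ x + pθ x)) ∂μ := by
    rw [← lintegral_const_mul' _ _ (by norm_num)]
    refine le_trans (setLIntegral_mono' (measurableSet_lt measurable_const hp₀m) ?_)
      (setLIntegral_le_lintegral _ _)
    intro x hx
    have hx : 0 < p₀ x := hx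
    obtain ⟨h1, h2⟩ := hD x hx
    have hS : 0 ≤ p₀ x + pθ x := by linarith [hpθ0 x]
    have hl := hl0 x
    have hu := hlu x
    rw [show (2 : ℝ≥0∞) = ENNReal.ofReal 2 by simp, ← ENNReal.ofReal_mul (by norm_num)]
    apply ENNReal.ofReal_le_ofReal
    rw [Real.exp_log (div_pos (by linarith) (by linarith))]
    have h3 := mul_le_mul_of_nonneg_right (aux_pt_s11 (u x) (l x) _ hl hu h1) hS
    rw [mul_assoc, h2] at h3
    linarith
  calc _ ≤ 2 * (2 * ∫⁻ x, ENNReal.ofReal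
        ((Real.sqrt (u x) - Real.sqrt (l x)) ^ 2 * (p₀ x + pθ x)) ∂μ) := by gcongr
    _ = _ := by rw [← mul_assoc]; norm_num
end
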